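/- Let ξ, C ∈ ℂ and let u, W, S : ℝ² → ℂ be smooth functions with S² = −W_x² + ξ²W² + C and W_xx = 2uS + ξ²W on ℝ². Define U = W_x + ξW, V = W_x − ξW and S̃ = −S. Then S̃² = C − UV, and U_x = ξU − 2uS̃, V_x = −ξV − 2uS̃ hold on ℝ². (Thus the second-order generalized invariant manifold for mKdV in potential form is transformed, via λ = ξ², into the first-order generalized invariant manifold of NLS type with v = u.) -/

import Mathlib

open Complex

/-- Partial derivative with respect to the first variable `x`. -/
noncomputable def dX (f : ℝ → ℝ → ℂ) : ℝ → ℝ → ℂ := fun x t => deriv (fun y => f y t) x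

/-- `f` is a smooth function of `(x,t) ∈ ℝ²`. -/
def Smooth2 (f : ℝ → ℝ → ℂ) : Prop := ContDiff ℝ (⊤ : ℕ∞) (fun p : ℝ × ℝ => f p.1 p.2)

/-- Smoothness in `(x,t)` restricts to smoothness on each horizontal line. -/
theorem Smooth2.contDiff_slice {f : ℝ → ℝ → ℂ} (hf : Smooth2 f) (t : ℝ) :
    ContDiff ℝ (⊤ : ℕ∞) (fun y => f y t) :=
  ContDiff.comp (g := fun p : ℝ × ℝ => f p.1 p.2) hf (contDiff_id.prodMk contDiff_const)

theorem Smooth2.hasDerivAt {f : ℝ → ℝ → ℂ} (hf : Smooth2 f) (x t : ℝ) :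
    HasDerivAt (fun y => f y t) (dX f x t) x :=
  ((hf.contDiff_slice t).differentiable (by simp) x).hasDerivAt

theorem Smooth2.hasDerivAt_dX {f : ℝ → ℝ → ℂ} (hf : Smooth2 f) (x t : ℝ) :
    HasDerivAt (fun y => dX f y t) (dX (dX f) x t) x :=
  (((contDiff_infty_iff_deriv.1 (hf.contDiff_slice t)).2).differentiable (by simp) x).hasDerivAt

/-- The second-order generalized invariant manifold `W_xx = 2uS + ξ²W`,
`S² = −W_x² + ξ²W² + C` for mKdV in potential form transforms, via
`U = W_x + ξW`, `V = W_x − ξW`, `S̃ = −S` and `λ = ξ²`, into the first-order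
generalized invariant manifold of NLS type with `v = u`. -/
theorem mkdv_gim_to_nls_gim
    (ξ C : ℂ) (u W S : ℝ → ℝ → ℂ)
    (hu : Smooth2 u) (hW : Smooth2 W) (hS : Smooth2 S)
    (hS2 : ∀ x t, (S x t) ^ 2 = -(dX W x t) ^ 2 + ξ ^ 2 * (W x t) ^ 2 + C)
    (hWxx : ∀ x t, dX (dX W) x t = 2 * u x t * S x t + ξ ^ 2 * W x t) :
    let U : ℝ → ℝ → ℂ := fun x t => dX W x t + ξ * W x t
    let V : ℝ → ℝ → ℂ := fun x t => dX W x t - ξ * W x t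
    let S' : ℝ → ℝ → ℂ := fun x t => -S x t
    (∀ x t, (S' x t) ^ 2 = C - U x t * V x t) ∧
    (∀ x t, dX U x t = ξ * U x t - 2 * u x t * S' x t) ∧
    (∀ x t, dX V x t = -ξ * V x t - 2 * u x t * S' x t) := by
  intro U V S'
  refine ⟨fun x t => ?_, fun x t => ?_, fun x t => ?_⟩
  · linear_combination hS2 x t
  · have h : dX U x t = dX (dX W) x t + ξ * dX W x t :=
      ((hW.hasDerivAt_dX x t).add ((hW.hasDerivAt x t).const_mul ξ)).deriv
    linear_combination h + hWxx x t
  · have h : dX V x t = dX (dX W) x t - ξ * dX W x t :=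
      ((hW.hasDerivAt_dX x t).sub ((hW.hasDerivAt x t).const_mul ξ)).deriv
    linear_combination h + hWxx x t
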